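/- Let 𝒲, 𝒲̂, 𝒳, 𝒴, 𝒵, 𝓑 be finite sets with |𝓑| ≥ 2, P_W, P_Ŵ distributions on 𝒲, 𝒲̂, and π_{XYZ} a distribution on 𝒳×𝒴×𝒵 such that there exists a pair (y,z) with π_{YZ|X}(y,z|x) > 0 for every x with π_X(x) > 0. Let Γ(π_{XYZ}, P_W P_Ŵ) be the limit as n→∞ of (1/n) times the infimum over all broadcast sequential codes of blocklength n of D(P_{Y^n Z^n|X^n} ‖ π_{YZ|X}^n | π_X^n). Then Γ(π_{XYZ}, P_W P_Ŵ) ≥ Δ(π_{XYZ}, P_W P_Ŵ), where Δ is the minimum, over finite auxiliary alphabets 𝒰, 𝒰̂, 𝒱 and distributions P_{UÛV}, P_{B|XUÛV}, P_{Y|BUÛV}, P_{Z|BUV} satisfying both H(U|V) ≤ H(W) + H(BU|XYZV) and H(UÛ|V) ≤ H(Ŵ) + H(W) + H(BUÛ|XYZV), of D(P_{YZ|XV} ‖ π_{YZ|X} | π_X P_V), with all entropies evaluated under the joint distribution π_X P_{UÛV} P_{B|XUÛV} P_{Y|BUÛV} P_{Z|BUV}. -/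

import Mathlib

open scoped BigOperators ENNReal
open Classical

noncomputable section

/-- `p` is a probability mass function on the finite type `α`. -/
def IsDist {α : Type} [Fintype α] (p : α → ℝ) : Prop :=
  (∀ a, 0 ≤ p a) ∧ (∑ a, p a) = 1

/-- `k` is a conditional probability kernel. -/
def IsKernel {α β : Type} [Fintype β] (k : α → β → ℝ) : Prop :=
  ∀ a, (∀ b, 0 ≤ k a b) ∧ (∑ b, k a b) = 1

/-- Marginal (pushforward) of `p` along the map `f`. -/
def marg {α β : Type} [Fintype α] (f : α → β) (p : α → ℝ) : β → ℝ :=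
  fun b => ∑ a, if f a = b then p a else 0

/-- Shannon entropy (natural log). -/
def ent {α : Type} [Fintype α] (p : α → ℝ) : ℝ :=
  ∑ a, Real.negMulLog (p a)

/-- Conditional entropy `H(f(A) | g(A))` for `A ∼ p`. -/
def condEnt {α β γ : Type} [Fintype α] [Fintype β] [Fintype γ]
    (f : α → β) (g : α → γ) (p : α → ℝ) : ℝ :=
  ent (marg (fun a => (f a, g a)) p) - ent (marg g p)

/-- Kullback–Leibler divergence `D(p‖q)` with value `⊤` if `p` is not absolutely
continuous with respect to `q`. -/
def KL {α : Type} [Fintype α] (p q : α → ℝ) : ℝ≥0∞ :=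
  if ∀ a, q a = 0 → p a = 0 then ENNReal.ofReal (∑ a, p a * Real.log (p a / q a)) else ⊤


/-- Conditional mutual information `I(f(A); g(A) | h(A))` for `A ∼ p`. -/
def condMI {α β γ δ : Type} [Fintype α] [Fintype β] [Fintype γ] [Fintype δ]
    (f : α → β) (g : α → γ) (h : α → δ) (p : α → ℝ) : ℝ :=
  condEnt f h p + condEnt g h p - condEnt (fun a => (f a, g a)) h p

/-- The joint distribution `π_X P_{UÛV} P_{B|XUÛV} P_{Y|BUÛV} P_{Z|BUV}`
on `X × U × Û × V × B × Y × Z`. -/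
def bJoint {X Y Z B U Uh V : Type} (πX : X → ℝ) (PUUV : U × Uh × V → ℝ)
    (PB : X × U × Uh × V → B → ℝ) (PY : B × U × Uh × V → Y → ℝ)
    (PZ : B × U × V → Z → ℝ) : X × U × Uh × V × B × Y × Z → ℝ :=
  fun q => πX q.1 * PUUV (q.2.1, q.2.2.1, q.2.2.2.1) *
    PB (q.1, q.2.1, q.2.2.1, q.2.2.2.1) q.2.2.2.2.1 *
    PY (q.2.2.2.2.1, q.2.1, q.2.2.1, q.2.2.2.1) q.2.2.2.2.2.1 *
    PZ (q.2.2.2.2.1, q.2.1, q.2.2.2.1) q.2.2.2.2.2.2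

/-- Feasible values of `D(P_{YZ|XV} ‖ π_{YZ|X} | π_X P_V)` for the broadcast lower
bound `Δ(π_{XYZ}, P_W P_Ŵ)`: the constraints are `H(U|V) ≤ h_W + H(BU|XYZV)` and
`H(UÛ|V) ≤ h_Ŵ + h_W + H(BUÛ|XYZV)`.  If `extra = true`, the term
`I(B;Û|XYZUV)` is added to the left side of the first constraint (giving `Δ̂`). -/
def bDeltaSet (X Y Z B : Type) [Fintype X] [Fintype Y] [Fintype Z] [Fintype B]
    (π : X × Y × Z → ℝ) (hW hWh : ℝ) (extra : Bool) : Set ℝ≥0∞ :=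
  { d | ∃ (m mh l : ℕ) (PUUV : Fin m × Fin mh × Fin l → ℝ)
      (PB : X × Fin m × Fin mh × Fin l → B → ℝ)
      (PY : B × Fin m × Fin mh × Fin l → Y → ℝ)
      (PZ : B × Fin m × Fin l → Z → ℝ),
      IsDist PUUV ∧ IsKernel PB ∧ IsKernel PY ∧ IsKernel PZ ∧
      (condEnt (fun q : X × Fin m × Fin mh × Fin l × B × Y × Z => q.2.1)
          (fun q => q.2.2.2.1)
          (bJoint (marg (fun p : X × Y × Z => p.1) π) PUUV PB PY PZ) +
        (if extra then
          condMI (fun q : X × Fin m × Fin mh × Fin l × B × Y × Z => q.2.2.2.2.1)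
            (fun q => q.2.2.1)
            (fun q => (q.1, q.2.2.2.2.2.1, q.2.2.2.2.2.2, q.2.1, q.2.2.2.1))
            (bJoint (marg (fun p : X × Y × Z => p.1) π) PUUV PB PY PZ)
        else 0) ≤
        hW + condEnt (fun q : X × Fin m × Fin mh × Fin l × B × Y × Z =>
            (q.2.2.2.2.1, q.2.1))
          (fun q => (q.1, q.2.2.2.2.2.1, q.2.2.2.2.2.2, q.2.2.2.1))
          (bJoint (marg (fun p : X × Y × Z => p.1) π) PUUV PB PY PZ)) ∧
      condEnt (fun q : X × Fin m × Fin mh × Fin l × B × Y × Z => (q.2.1, q.2.2.1))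
          (fun q => q.2.2.2.1)
          (bJoint (marg (fun p : X × Y × Z => p.1) π) PUUV PB PY PZ) ≤
        hWh + hW +
          condEnt (fun q : X × Fin m × Fin mh × Fin l × B × Y × Z =>
              (q.2.2.2.2.1, q.2.1, q.2.2.1))
            (fun q => (q.1, q.2.2.2.2.2.1, q.2.2.2.2.2.2, q.2.2.2.1))
            (bJoint (marg (fun p : X × Y × Z => p.1) π) PUUV PB PY PZ) ∧
      d = KL
          (marg (fun q : X × Fin m × Fin mh × Fin l × B × Y × Z =>
              (q.1, q.2.2.2.1, q.2.2.2.2.2.1, q.2.2.2.2.2.2))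
            (bJoint (marg (fun p : X × Y × Z => p.1) π) PUUV PB PY PZ))
          (fun r : X × Fin l × Y × Z =>
            marg (fun p : Fin m × Fin mh × Fin l => p.2.2) PUUV r.2.1 *
              π (r.1, r.2.2.1, r.2.2.2)) }

/-- A broadcast sequential code of blocklength `n`. -/
structure BCode (W Wh X Y Z B : Type) [Fintype W] [Fintype Wh] [Fintype X]
    [Fintype Y] [Fintype Z] [Fintype B] (n : ℕ) where
  enc : Fin n → (Fin n → W) → (Fin n → Wh) → (Fin n → X) → (Fin n → B) → B → ℝ
  decY : Fin n → (Fin n → W) → (Fin n → Wh) → (Fin n → B) → (Fin n → Y) → Y → ℝ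
  decZ : Fin n → (Fin n → W) → (Fin n → B) → (Fin n → Z) → Z → ℝ
  enc_dist : ∀ k w wh x b, IsDist (enc k w wh x b)
  decY_dist : ∀ k w wh b y, IsDist (decY k w wh b y)
  decZ_dist : ∀ k w b z, IsDist (decZ k w b z)
  enc_causal : ∀ k w w' wh wh' x x' b b',
    (∀ i, i ≤ k → w i = w' i) → (∀ i, i ≤ k → wh i = wh' i) →
    (∀ i, i ≤ k → x i = x' i) → (∀ i, i < k → b i = b' i) →
    enc k w wh x b = enc k w' wh' x' b'
  decY_causal : ∀ k w w' wh wh' b b' y y',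
    (∀ i, i ≤ k → w i = w' i) → (∀ i, i ≤ k → wh i = wh' i) →
    (∀ i, i ≤ k → b i = b' i) → (∀ i, i < k → y i = y' i) →
    decY k w wh b y = decY k w' wh' b' y'
  decZ_causal : ∀ k w w' b b' z z',
    (∀ i, i ≤ k → w i = w' i) → (∀ i, i ≤ k → b i = b' i) →
    (∀ i, i < k → z i = z' i) →
    decZ k w b z = decZ k w' b' z'

/-- The broadcast channel `P_{Y^n Z^n|X^n}` synthesized by a broadcast code. -/
def BCode.channel {W Wh X Y Z B : Type} [Fintype W] [Fintype Wh] [Fintype X]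
    [Fintype Y] [Fintype Z] [Fintype B] {n : ℕ} (C : BCode W Wh X Y Z B n)
    (PW : W → ℝ) (PWh : Wh → ℝ)
    (x : Fin n → X) (y : Fin n → Y) (z : Fin n → Z) : ℝ :=
  ∑ w : Fin n → W, ∑ wh : Fin n → Wh, ∑ b : Fin n → B,
    (∏ k, PW (w k)) * (∏ k, PWh (wh k)) * (∏ k, C.enc k w wh x b (b k)) *
      (∏ k, C.decY k w wh b y (y k)) * (∏ k, C.decZ k w b z (z k))

/-- Least divergence over broadcast sequential codes of blocklength `n`. -/
def BGammaN (W Wh X Y Z B : Type) [Fintype W] [Fintype Wh] [Fintype X]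
    [Fintype Y] [Fintype Z] [Fintype B]
    (PW : W → ℝ) (PWh : Wh → ℝ) (π : X × Y × Z → ℝ) (n : ℕ) : ℝ≥0∞ :=
  sInf { d | ∃ C : BCode W Wh X Y Z B n,
    d = KL
      (fun p : (Fin n → X) × (Fin n → Y) × (Fin n → Z) =>
        (∏ i, marg (fun q : X × Y × Z => q.1) π (p.1 i)) *
          C.channel PW PWh p.1 p.2.1 p.2.2)
      (fun p : (Fin n → X) × (Fin n → Y) × (Fin n → Z) =>
        ∏ i, π (p.1 i, p.2.1 i, p.2.2 i)) }

lemma sum_fin_succ_eq {n : ℕ} (f : ℕ → ℝ) :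
    ∑ k : Fin n, f (k + 1) = ∑ k : Fin n, f k + (f n - f 0) := by
  rw [← Finset.sum_range_sub, ← Fin.sum_univ_eq_sum_range fun k => f (k + 1) - f k,
    ← Finset.sum_add_distrib]
  simp

lemma sum_sub_le_of_telescoping {n : ℕ} (hn : n ≠ 0) {c : ℝ} {s v : ℕ → ℝ} {r : Fin n → ℝ}
    (hr : ∀ k, r k = c + s k) (hs : s 0 = 0) (hv : v 0 = 0) (hsv : v n ≤ s n) :
    (∑ k, r k) / n - (∑ k : Fin n, v k) / n ≤
      c + ((∑ k : Fin n, s (k + 1)) / n - (∑ k : Fin n, v (k + 1)) / n) := by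
  have hn' : (0 : ℝ) < n := by exact_mod_cast hn.bot_lt
  have := (div_le_div_iff_of_pos_right hn').mpr hsv
  simp only [hr, sum_fin_succ_eq, Finset.sum_add_distrib, hs, hv, sub_zero, add_div,
    Finset.sum_const, Finset.card_univ, Fintype.card_fin, nsmul_eq_mul,
    mul_div_cancel_left₀ c hn'.ne']
  linarith

section FiniteEntropy

variable {α β γ δ : Type} [Fintype α]

lemma sum_marg_mul [Fintype β] (f : α → β) (p : α → ℝ) (g : β → ℝ) :
    ∑ b, marg f p b * g b = ∑ a, p a * g (f a) := by
  simp only [marg, Finset.sum_mul]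
  rw [Finset.sum_comm]
  refine Finset.sum_congr rfl fun a _ => ?_
  rw [Finset.sum_eq_single (f a)]
  · simp
  · intro b _ hb
    simp [Ne.symm hb]
  · simp

lemma marg_nonneg (f : α → β) {p : α → ℝ} (hp : ∀ a, 0 ≤ p a) (b : β) : 0 ≤ marg f p b :=
  Finset.sum_nonneg fun a _ => by split_ifs <;> simp [hp]

lemma isDist_marg [Fintype β] (f : α → β) {p : α → ℝ} (hp : IsDist p) : IsDist (marg f p) :=
  ⟨marg_nonneg f hp.1, by simpa [hp.2] using sum_marg_mul f p fun _ => 1⟩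

lemma le_marg (f : α → β) {p : α → ℝ} (hp : ∀ a, 0 ≤ p a) (a : α) : p a ≤ marg f p (f a) := by
  have := Finset.single_le_sum (f := fun a' => if f a' = f a then p a' else 0)
    (fun a' _ => by split_ifs <;> simp [hp]) (Finset.mem_univ a)
  simpa [marg] using this

lemma marg_pos (f : α → β) {p : α → ℝ} (hp : ∀ a, 0 ≤ p a) {a : α} (ha : p a ≠ 0) :
    0 < marg f p (f a) :=
  (lt_of_le_of_ne (hp a) ha.symm).trans_le (le_marg f hp a)

lemma marg_marg [Fintype β] (f : α → β) (g : β → γ) (p : α → ℝ) :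
    marg g (marg f p) = marg (fun a => g (f a)) p := by
  funext c
  have := sum_marg_mul f p fun b => if g b = c then 1 else 0
  simpa [marg] using this

lemma marg_apply_congr {f : α → β} {g : α → γ} (p : α → ℝ)
    (h : ∀ a a', f a = f a' ↔ g a = g a') (a : α) : marg f p (f a) = marg g p (g a) := by
  simp only [marg, h]

lemma marg_apply_congr_iff {f : α → β} {g : α → γ} (p : α → ℝ) {b : β} {c : γ}
    (h : ∀ a, f a = b ↔ g a = c) : marg f p b = marg g p c := by
  simp only [marg, h]

lemma ent_marg [Fintype β] (f : α → β) (p : α → ℝ) :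
    ent (marg f p) = -∑ a, p a * Real.log (marg f p (f a)) := by
  rw [← sum_marg_mul f p fun b => Real.log (marg f p b)]
  simp [ent, Real.negMulLog]

lemma ent_marg_congr [Fintype β] [Fintype γ] {f : α → β} {g : α → γ} (p : α → ℝ)
    (h : ∀ a a', f a = f a' ↔ g a = g a') : ent (marg f p) = ent (marg g p) := by
  simp only [ent_marg, marg_apply_congr p h]

lemma ent_marg_mono [Fintype β] [Fintype γ] {f : α → β} {g : α → γ} {p : α → ℝ}
    (hp : ∀ a, 0 ≤ p a) (h : ∀ a a', f a = f a' → g a = g a') :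
    ent (marg g p) ≤ ent (marg f p) := by
  simp only [ent_marg]
  refine neg_le_neg (Finset.sum_le_sum fun a _ => ?_)
  by_cases ha : p a = 0
  · simp [ha]
  refine mul_le_mul_of_nonneg_left (Real.log_le_log (marg_pos f hp ha) ?_) (hp a)
  refine Finset.sum_le_sum fun a' _ => ?_
  by_cases hf : f a' = f a
  · simp [hf, h _ _ hf]
  · simp only [hf, if_false]
    split_ifs <;> simp [hp]

lemma ent_prod [Fintype β] {p : α → ℝ} {q : β → ℝ} (hp : IsDist p) (hq : IsDist q) :
    ent (fun r : α × β => p r.1 * q r.2) = ent p + ent q := by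
  simp only [ent, Fintype.sum_prod_type, Real.negMulLog_mul, Finset.sum_add_distrib,
    ← Finset.sum_mul, ← Finset.mul_sum, hp.2, hq.2]
  simp

lemma condEnt_marg [Fintype β] [Fintype γ] [Fintype δ] (R : α → β) (f : β → γ) (g : β → δ)
    (p : α → ℝ) :
    condEnt f g (marg R p) =
      ent (marg (fun a => (f (R a), g (R a))) p) - ent (marg (fun a => g (R a)) p) := by
  simp only [condEnt, marg_marg]

lemma ent_marg_of_const [Fintype β] {f : α → β} {p : α → ℝ} (hp : IsDist p)
    (h : ∀ a a', f a = f a') : ent (marg f p) = 0 := by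
  rw [ent_marg, neg_eq_zero]
  refine Finset.sum_eq_zero fun a _ => ?_
  have : marg f p (f a) = 1 := by
    rw [← hp.2]
    exact Finset.sum_congr rfl fun a' _ => if_pos (h _ _)
  simp [this]

lemma KL_marg [Fintype β] (f : α → β) {p : α → ℝ} (hp : ∀ a, 0 ≤ p a) {q : β → ℝ}
    (h : ∀ b, q b = 0 → marg f p b = 0) :
    KL (marg f p) q = ENNReal.ofReal (-ent (marg f p) - ∑ a, p a * Real.log (q (f a))) := by
  rw [KL, if_pos h, sum_marg_mul f p fun b => Real.log (marg f p b / q b), ent_marg, neg_neg,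
    ← Finset.sum_sub_distrib]
  congr 1
  refine Finset.sum_congr rfl fun a _ => ?_
  by_cases ha : p a = 0
  · simp [ha]
  · have hm := (marg_pos f hp ha).ne'
    rw [Real.log_div hm (mt (h _) hm), mul_sub]

lemma KL_comp_equiv [Fintype β] (e : α ≃ β) (p q : β → ℝ) :
    KL (fun a => p (e a)) (fun a => q (e a)) = KL p q := by
  have h : (∀ a, q (e a) = 0 → p (e a) = 0) ↔ ∀ b, q b = 0 → p b = 0 :=
    e.forall_congr_left.trans (by simp)
  simp only [KL, h]
  rw [e.sum_comp fun b => p b * Real.log (p b / q b)]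

/-- The law of `(Q, A)` where `Q` is uniform on `Fin n` and independent of `A ∼ p`. -/
def timeShare (n : ℕ) (p : α → ℝ) : Fin n × α → ℝ := fun q => p q.2 / n

lemma isDist_timeShare {n : ℕ} (hn : n ≠ 0) {p : α → ℝ} (hp : IsDist p) :
    IsDist (timeShare n p) := by
  refine ⟨fun q => div_nonneg (hp.1 _) n.cast_nonneg, ?_⟩
  have : (n : ℝ) ≠ 0 := by exact_mod_cast hn
  simp [timeShare, Fintype.sum_prod_type, ← Finset.sum_div, hp.2, this]

lemma sum_timeShare_mul (n : ℕ) (p : α → ℝ) (g : Fin n × α → ℝ) :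
    ∑ q, timeShare n p q * g q = (∑ k, ∑ a, p a * g (k, a)) / n := by
  simp only [timeShare, Fintype.sum_prod_type, Finset.sum_div]
  exact Finset.sum_congr rfl fun k _ => Finset.sum_congr rfl fun a _ => by ring

lemma marg_timeShare (n : ℕ) (p : α → ℝ) (F : Fin n → α → β) (k : Fin n) (b : β) :
    marg (fun q : Fin n × α => (q.1, F q.1 q.2)) (timeShare n p) (k, b) =
      marg (F k) p b / n := by
  simp only [marg, timeShare, Fintype.sum_prod_type, Prod.mk.injEq]
  rw [Finset.sum_eq_single k]
  · simp only [true_and, Finset.sum_div, ite_div, zero_div]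
  · intro k' _ hk
    simp [hk]
  · simp

lemma ent_timeShare [Fintype β] {n : ℕ} (hn : n ≠ 0) {p : α → ℝ} (hp : IsDist p)
    (F : Fin n → α → β) :
    ent (marg (fun q : Fin n × α => (q.1, F q.1 q.2)) (timeShare n p)) =
      Real.log n + (∑ k, ent (marg (F k) p)) / n := by
  have hn' : (n : ℝ) ≠ 0 := by exact_mod_cast hn
  rw [ent_marg, sum_timeShare_mul]
  have (k : Fin n) : ∑ a, p a * Real.log (marg (fun q : Fin n × α => (q.1, F q.1 q.2))
      (timeShare n p) (k, F k a)) = -ent (marg (F k) p) - Real.log n := by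
    rw [ent_marg, neg_neg]
    calc _ = ∑ a, (p a * Real.log (marg (F k) p (F k a)) - p a * Real.log n) := by
          refine Finset.sum_congr rfl fun a _ => ?_
          rw [marg_timeShare]
          by_cases ha : p a = 0
          · simp [ha]
          · rw [Real.log_div (marg_pos _ hp.1 ha).ne' hn', mul_sub]
      _ = _ := by rw [Finset.sum_sub_distrib, ← Finset.sum_mul, hp.2, one_mul]
  simp only [this, Finset.sum_sub_distrib, Finset.sum_neg_distrib, Finset.sum_const,
    Finset.card_univ, Fintype.card_fin, nsmul_eq_mul]
  field_simp
  ring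

end FiniteEntropy

section CausalProduct

variable {A : Type}

/-- The factors of a causal product law: the `k`-th one is a probability mass function of the
`k`-th coordinate and depends only on the coordinates up to `k`. -/
structure IsCausal [Fintype A] {n : ℕ} (K : Fin n → (Fin n → A) → ℝ) : Prop where
  nonneg : ∀ k ω, 0 ≤ K k ω
  sum_eq_one : ∀ k ω, ∑ a, K k (Function.update ω k a) = 1
  congr : ∀ k ω ω', (∀ i ≤ k, ω i = ω' i) → K k ω = K k ω'

lemma sum_snoc [Fintype A] {n : ℕ} (F : (Fin (n + 1) → A) → ℝ) :
    ∑ ω, F ω = ∑ ω : Fin n → A, ∑ a, F (Fin.snoc ω a) := by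
  rw [← (Fin.snocEquiv fun _ : Fin (n + 1) => A).sum_comp, Fintype.sum_prod_type_right]
  rfl

lemma snoc_update_castSucc {n : ℕ} (ω : Fin n → A) (a : A) (k : Fin n) (c : A) :
    (Fin.snoc (Function.update ω k c) a : Fin (n + 1) → A) =
      Function.update (Fin.snoc ω a : Fin (n + 1) → A) k.castSucc c :=
  Fin.snoc_update ..

namespace IsCausal

variable [Fintype A]

lemma restrict {n : ℕ} {K : Fin (n + 1) → (Fin (n + 1) → A) → ℝ} (hK : IsCausal K) (a₀ : A) :
    IsCausal fun (k : Fin n) ω => K k.castSucc (Fin.snoc ω a₀) where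
  nonneg k ω := hK.nonneg _ _
  sum_eq_one k ω := by
    simp only [snoc_update_castSucc]
    exact hK.sum_eq_one _ _
  congr k ω ω' h := hK.congr _ _ _ fun i hi => by
    induction i using Fin.lastCases with
    | last => exact absurd hi (not_le.mpr (Fin.castSucc_lt_last k))
    | cast i => simpa using h i (by simpa using hi)

lemma congr_snoc {n : ℕ} {K : Fin (n + 1) → (Fin (n + 1) → A) → ℝ} (hK : IsCausal K)
    (k : Fin n) (ω : Fin n → A) (a a' : A) :
    K k.castSucc (Fin.snoc ω a) = K k.castSucc (Fin.snoc ω a') :=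
  hK.congr _ _ _ fun i hi => by
    induction i using Fin.lastCases with
    | last => exact absurd hi (not_le.mpr (Fin.castSucc_lt_last k))
    | cast i => simp

lemma sum_prod_snoc {n : ℕ} {K : Fin (n + 1) → (Fin (n + 1) → A) → ℝ} (hK : IsCausal K)
    (a₀ : A) (F : (Fin (n + 1) → A) → ℝ) :
    ∑ ω, (∏ i, K i ω) * F ω = ∑ ω : Fin n → A, (∏ i : Fin n, K i.castSucc (Fin.snoc ω a₀)) *
      ∑ a, K (Fin.last n) (Fin.snoc ω a) * F (Fin.snoc ω a) := by
  rw [sum_snoc]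
  refine Finset.sum_congr rfl fun ω _ => ?_
  rw [Finset.mul_sum]
  refine Finset.sum_congr rfl fun a _ => ?_
  rw [Fin.prod_univ_castSucc, mul_assoc]
  simp only [hK.congr_snoc _ ω a a₀]

lemma sum_last {n : ℕ} {K : Fin (n + 1) → (Fin (n + 1) → A) → ℝ} (hK : IsCausal K)
    (a₀ : A) (ω : Fin n → A) : ∑ a, K (Fin.last n) (Fin.snoc ω a) = 1 := by
  simpa [Fin.update_snoc_last] using hK.sum_eq_one (Fin.last n) (Fin.snoc ω a₀)

lemma sum_prod (a₀ : A) {n : ℕ} {K : Fin n → (Fin n → A) → ℝ} (hK : IsCausal K) :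
    ∑ ω, ∏ i, K i ω = 1 := by
  induction n with
  | zero => simp
  | succ n ih => simpa [hK.sum_last a₀, ih (hK.restrict a₀)] using hK.sum_prod_snoc a₀ fun _ => 1

lemma isDist (a₀ : A) {n : ℕ} {K : Fin n → (Fin n → A) → ℝ} (hK : IsCausal K) :
    IsDist fun ω => ∏ i, K i ω :=
  ⟨fun _ => Finset.prod_nonneg fun _ _ => hK.nonneg _ _, hK.sum_prod a₀⟩

/-- Resampling the `k`-th coordinate from its conditional law does not change the expectation of a
function of the coordinates up to `k`. -/
lemma sum_resample (a₀ : A) {n : ℕ} {K : Fin n → (Fin n → A) → ℝ} (hK : IsCausal K) (k : Fin n)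
    (F : (Fin n → A) → ℝ) (hF : ∀ ω ω', (∀ i ≤ k, ω i = ω' i) → F ω = F ω') :
    ∑ ω, (∏ i, K i ω) * F ω = ∑ ω, (∏ i, K i ω) *
      ∑ a, K k (Function.update ω k a) * F (Function.update ω k a) := by
  induction n with
  | zero => exact k.elim0
  | succ n ih =>
    rw [hK.sum_prod_snoc a₀, hK.sum_prod_snoc a₀]
    induction k using Fin.lastCases with
    | last =>
      simp only [Fin.update_snoc_last, ← Finset.sum_mul, hK.sum_last a₀, one_mul]
    | cast k =>
      have hF' (ω : Fin n → A) (a : A) : F (Fin.snoc ω a) = F (Fin.snoc ω a₀) :=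
        hF _ _ fun i hi => by
          induction i using Fin.lastCases with
          | last => exact absurd hi (not_le.mpr (Fin.castSucc_lt_last k))
          | cast i => simp
      simp only [← snoc_update_castSucc, hF', hK.congr_snoc _ _ _ a₀, ← Finset.sum_mul,
        hK.sum_last a₀, one_mul]
      refine ih (hK.restrict a₀) k (fun ω => F (Fin.snoc ω a₀)) fun ω ω' h => hF _ _ fun i hi => ?_
      induction i using Fin.lastCases with
      | last => exact absurd hi (not_le.mpr (Fin.castSucc_lt_last k))
      | cast i => simpa using h i (by simpa using hi)

/-- If the conditional law of `f (ω k)` given the past is always `μ`, then `f (ω k)` is independent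
of the past. -/
lemma marg_prod {β γ : Type} [Fintype β] (a₀ : A) {n : ℕ} {K : Fin n → (Fin n → A) → ℝ}
    (hK : IsCausal K) (k : Fin n) (f : A → β) (μ : β → ℝ)
    (hμ : ∀ ω b, ∑ a, (if f a = b then K k (Function.update ω k a) else 0) = μ b)
    (S : (Fin n → A) → γ) (hS : ∀ ω ω', (∀ i < k, ω i = ω' i) → S ω = S ω') :
    marg (fun ω => (f (ω k), S ω)) (fun ω => ∏ i, K i ω) =
      fun r => μ r.1 * marg S (fun ω => ∏ i, K i ω) r.2 := by
  funext ⟨b, c⟩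
  have := hK.sum_resample a₀ k (fun ω => if (f (ω k), S ω) = (b, c) then 1 else 0)
    fun ω ω' h => by rw [h k le_rfl, hS ω ω' fun i hi => h i hi.le]
  have hS' (ω : Fin n → A) (a : A) : S (Function.update ω k a) = S ω :=
    hS _ _ fun i hi => Function.update_of_ne hi.ne _ _
  simp only [mul_ite, mul_one, mul_zero] at this
  simp only [marg]
  rw [this, Finset.mul_sum]
  refine Finset.sum_congr rfl fun ω _ => ?_
  simp only [hS', Function.update_self, Prod.mk.injEq]
  by_cases hc : S ω = c
  · simp only [hc, and_true, if_true, hμ]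
    ring
  · simp [hc]

end IsCausal

end CausalProduct

section SingleLetter

variable {X Y Z B : Type} [Fintype X] [Fintype Y] [Fintype Z] [Fintype B]

/-- Auxiliary random variables on arbitrary finite alphabets and an arbitrary finite probability
space yield an element of `bDeltaSet`. -/
lemma KL_mem_bDeltaSet {Ω U Uh V : Type} [Fintype Ω] [Fintype U] [Fintype Uh] [Fintype V]
    {π : X × Y × Z → ℝ} {hW hWh : ℝ} {p : Ω → ℝ} (hp : IsDist p)
    (x : Ω → X) (u : Ω → U) (uh : Ω → Uh) (v : Ω → V) (b : Ω → B) (y : Ω → Y) (z : Ω → Z)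
    {PB : X × U × Uh × V → B → ℝ} {PY : B × U × Uh × V → Y → ℝ} {PZ : B × U × V → Z → ℝ}
    (hPB : IsKernel PB) (hPY : IsKernel PY) (hPZ : IsKernel PZ)
    (hjoint : marg (fun ω => (x ω, u ω, uh ω, v ω, b ω, y ω, z ω)) p =
      bJoint (marg (fun q : X × Y × Z => q.1) π) (marg (fun ω => (u ω, uh ω, v ω)) p) PB PY PZ)
    (h₁ : ent (marg (fun ω => (u ω, v ω)) p) - ent (marg v p) ≤
      hW + (ent (marg (fun ω => ((b ω, u ω), x ω, y ω, z ω, v ω)) p) -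
        ent (marg (fun ω => (x ω, y ω, z ω, v ω)) p)))
    (h₂ : ent (marg (fun ω => ((u ω, uh ω), v ω)) p) - ent (marg v p) ≤
      hWh + hW + (ent (marg (fun ω => ((b ω, u ω, uh ω), x ω, y ω, z ω, v ω)) p) -
        ent (marg (fun ω => (x ω, y ω, z ω, v ω)) p))) :
    KL (marg (fun ω => (x ω, v ω, y ω, z ω)) p)
      (fun r => marg v p r.2.1 * π (r.1, r.2.2.1, r.2.2.2)) ∈ bDeltaSet X Y Z B π hW hWh false := by
  have eU := Fintype.equivFin U
  have eUh := Fintype.equivFin Uh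
  have eV := Fintype.equivFin V
  set PUUV : _ → ℝ := marg (fun ω => (eU (u ω), eUh (uh ω), eV (v ω))) p
  let PB' : X × _ × _ × _ → B → ℝ :=
    fun t => PB (t.1, eU.symm t.2.1, eUh.symm t.2.2.1, eV.symm t.2.2.2)
  let PY' : B × _ × _ × _ → Y → ℝ :=
    fun t => PY (t.1, eU.symm t.2.1, eUh.symm t.2.2.1, eV.symm t.2.2.2)
  let PZ' : B × _ × _ → Z → ℝ := fun t => PZ (t.1, eU.symm t.2.1, eV.symm t.2.2)
  have hJ : bJoint (marg (fun q : X × Y × Z => q.1) π) PUUV PB' PY' PZ' =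
      marg (fun ω => (x ω, eU (u ω), eUh (uh ω), eV (v ω), b ω, y ω, z ω)) p := by
    funext ⟨x', u', uh', v', b', y', z'⟩
    have := congrFun hjoint (x', eU.symm u', eUh.symm uh', eV.symm v', b', y', z')
    simp only [marg, Prod.mk.injEq, Equiv.eq_symm_apply, bJoint] at this
    simp only [PUUV, PB', PY', PZ', marg, Prod.mk.injEq, bJoint, this]
  have hV : marg (fun t : Fin (Fintype.card U) × Fin (Fintype.card Uh) × Fin (Fintype.card V) =>
      t.2.2) PUUV = marg (fun ω => eV (v ω)) p := marg_marg ..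
  refine ⟨_, _, _, PUUV, PB', PY', PZ', isDist_marg _ hp, fun _ => hPB _, fun _ => hPY _,
    fun _ => hPZ _, ?_, ?_, ?_⟩
  · rw [hJ]
    simp only [condEnt_marg]
    convert h₁ using 2
    · simp only [Bool.false_eq_true, if_false, add_zero]
      congr 1 <;> exact ent_marg_congr _ (by simp)
    · congr 1 <;> exact ent_marg_congr _ (by simp)
  · rw [hJ]
    simp only [condEnt_marg]
    convert h₂ using 2
    · exact ent_marg_congr _ (by simp)
    · exact ent_marg_congr _ (by simp)
    · congr 1 <;> exact ent_marg_congr _ (by simp)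
  · rw [hJ, marg_marg, hV]
    let e : X × V × Y × Z ≃ X × Fin (Fintype.card V) × Y × Z :=
      (Equiv.refl X).prodCongr (eV.prodCongr (Equiv.refl _))
    rw [← KL_comp_equiv e]
    congr 1
    · funext r
      simp [e, marg, Prod.ext_iff]
    · funext r
      simp [e, marg]

end SingleLetter

section CodeLaw

/-- The sequence that agrees with `f` on the first `k` coordinates and is constantly `d`
afterwards. -/
def truncate {α : Type} {n : ℕ} (d : α) (k : ℕ) (f : Fin n → α) : Fin n → α :=
  fun i => if i.val < k then f i else d

lemma truncate_eq_iff {α : Type} {n : ℕ} {d : α} {k : ℕ} {f g : Fin n → α} :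
    truncate d k f = truncate d k g ↔ ∀ i : Fin n, i.val < k → f i = g i := by
  refine ⟨fun h i hi => by simpa [truncate, hi] using congrFun h i, fun h => funext fun i => ?_⟩
  by_cases hi : i.val < k <;> simp [truncate, hi, h]

lemma truncate_succ_eq_iff {α : Type} {n : ℕ} {d : α} {k : Fin n} {f g : Fin n → α} :
    truncate d (k + 1) f = truncate d (k + 1) g ↔
      f k = g k ∧ truncate d k f = truncate d k g := by
  simp only [truncate_eq_iff, Nat.lt_succ_iff_lt_or_eq]
  constructor
  · exact fun h => ⟨h k (Or.inr rfl), fun i hi => h i (Or.inl hi)⟩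
  · rintro ⟨h, h'⟩ i (hi | hi)
    · exact h' i hi
    · rwa [Fin.ext hi]

namespace BCode

section Auxiliary

variable {W Wh X Y Z B : Type} {n : ℕ} (a₀ : W × Wh × X × B × Y × Z)

/-- `U_k = (W^k, B^{k-1})`. -/
def auxU (k : Fin n) (ω : Fin n → W × Wh × X × B × Y × Z) : (Fin n → W) × (Fin n → B) :=
  (truncate a₀.1 (k + 1) fun i => (ω i).1, truncate a₀.2.2.2.1 k fun i => (ω i).2.2.2.1)

/-- `Û_k = Ŵ^k`. -/
def auxUh (k : Fin n) (ω : Fin n → W × Wh × X × B × Y × Z) : Fin n → Wh :=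
  truncate a₀.2.1 (k + 1) fun i => (ω i).2.1

/-- `V_k = (X^{k-1}, Y^{k-1}, Z^{k-1})`. -/
def auxV (k : ℕ) (ω : Fin n → W × Wh × X × B × Y × Z) :
    (Fin n → X) × (Fin n → Y) × (Fin n → Z) :=
  (truncate a₀.2.2.1 k fun i => (ω i).2.2.1, truncate a₀.2.2.2.2.1 k fun i => (ω i).2.2.2.2.1,
    truncate a₀.2.2.2.2.2 k fun i => (ω i).2.2.2.2.2)

lemma auxU_congr {k : Fin n} {ω ω' : Fin n → W × Wh × X × B × Y × Z}
    (h : ∀ i < k, ω i = ω' i) (hk : (ω k).1 = (ω' k).1) : auxU a₀ k ω = auxU a₀ k ω' := by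
  simp only [auxU, Prod.mk.injEq, truncate_succ_eq_iff, truncate_eq_iff]
  exact ⟨⟨hk, fun i hi => by rw [h i hi]⟩, fun i hi => by rw [h i hi]⟩

lemma auxUh_congr {k : Fin n} {ω ω' : Fin n → W × Wh × X × B × Y × Z}
    (h : ∀ i < k, ω i = ω' i) (hk : (ω k).2.1 = (ω' k).2.1) : auxUh a₀ k ω = auxUh a₀ k ω' := by
  simp only [auxUh, truncate_succ_eq_iff, truncate_eq_iff]
  exact ⟨hk, fun i hi => by rw [h i hi]⟩

lemma auxV_congr {k : Fin n} {ω ω' : Fin n → W × Wh × X × B × Y × Z}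
    (h : ∀ i < k, ω i = ω' i) : auxV a₀ k ω = auxV a₀ k ω' := by
  simp only [auxV, Prod.mk.injEq, truncate_eq_iff]
  exact ⟨fun i hi => by rw [h i hi], fun i hi => by rw [h i hi], fun i hi => by rw [h i hi]⟩

/-- The past `(W^{k-1}, B^{k-1}, V_k)`. -/
def pastU (k : ℕ) (ω : Fin n → W × Wh × X × B × Y × Z) :
    (Fin n → W) × (Fin n → B) × (Fin n → X) × (Fin n → Y) × (Fin n → Z) :=
  (truncate a₀.1 k fun i => (ω i).1, truncate a₀.2.2.2.1 k fun i => (ω i).2.2.2.1, auxV a₀ k ω)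

/-- The past `(Ŵ^{k-1}, W^{k-1}, B^{k-1}, V_k)`. -/
def pastUUh (k : ℕ) (ω : Fin n → W × Wh × X × B × Y × Z) :
    (Fin n → Wh) × (Fin n → W) × (Fin n → B) × (Fin n → X) × (Fin n → Y) × (Fin n → Z) :=
  (truncate a₀.2.1 k fun i => (ω i).2.1, pastU a₀ k ω)

lemma pastU_congr {k : Fin n} {ω ω' : Fin n → W × Wh × X × B × Y × Z}
    (h : ∀ i < k, ω i = ω' i) : pastU a₀ k ω = pastU a₀ k ω' := by
  simp only [pastU, Prod.mk.injEq, truncate_eq_iff, auxV_congr a₀ h, and_true]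
  exact ⟨fun i hi => by rw [h i hi], fun i hi => by rw [h i hi]⟩

lemma pastUUh_congr {k : Fin n} {ω ω' : Fin n → W × Wh × X × B × Y × Z}
    (h : ∀ i < k, ω i = ω' i) : pastUUh a₀ k ω = pastUUh a₀ k ω' := by
  simp only [pastUUh, Prod.mk.injEq, truncate_eq_iff, pastU_congr a₀ h, and_true]
  exact fun i hi => by rw [h i hi]

end Auxiliary

variable {W Wh X Y Z B : Type} [Fintype W] [Fintype Wh] [Fintype X] [Fintype Y] [Fintype Z]
  [Fintype B] {n : ℕ} (C : BCode W Wh X Y Z B n) (PW : W → ℝ) (PWh : Wh → ℝ) (πX : X → ℝ)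

/-- The conditional probability of the `k`-th symbols `(W, Ŵ, X, B, Y, Z)` given the past. -/
def factor (k : Fin n) (ω : Fin n → W × Wh × X × B × Y × Z) : ℝ :=
  PW (ω k).1 * (PWh (ω k).2.1 * (πX (ω k).2.2.1 *
    (C.enc k (fun i => (ω i).1) (fun i => (ω i).2.1) (fun i => (ω i).2.2.1)
      (fun i => (ω i).2.2.2.1) (ω k).2.2.2.1 *
    (C.decY k (fun i => (ω i).1) (fun i => (ω i).2.1) (fun i => (ω i).2.2.2.1)
      (fun i => (ω i).2.2.2.2.1) (ω k).2.2.2.2.1 *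
    C.decZ k (fun i => (ω i).1) (fun i => (ω i).2.2.2.1) (fun i => (ω i).2.2.2.2.2)
      (ω k).2.2.2.2.2))))

lemma comp_update {α β : Type} (g : α → β) (ω : Fin n → α) (k : Fin n) (a : α) :
    (fun i => g (Function.update ω k a i)) = Function.update (fun i => g (ω i)) k (g a) :=
  Function.comp_update g ω k a

lemma factor_update (k : Fin n) (ω : Fin n → W × Wh × X × B × Y × Z) (w : W) (wh : Wh) (x : X)
    (b : B) (y : Y) (z : Z) :
    C.factor PW PWh πX k (Function.update ω k (w, wh, x, b, y, z)) =
      PW w * (PWh wh * (πX x *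
        (C.enc k (Function.update (fun i => (ω i).1) k w)
          (Function.update (fun i => (ω i).2.1) k wh) (Function.update (fun i => (ω i).2.2.1) k x)
          (fun i => (ω i).2.2.2.1) b *
        (C.decY k (Function.update (fun i => (ω i).1) k w)
          (Function.update (fun i => (ω i).2.1) k wh)
          (Function.update (fun i => (ω i).2.2.2.1) k b) (fun i => (ω i).2.2.2.2.1) y *
        C.decZ k (Function.update (fun i => (ω i).1) k w)
          (Function.update (fun i => (ω i).2.2.2.1) k b) (fun i => (ω i).2.2.2.2.2) z)))) := by
  simp only [factor, comp_update fun a : W × Wh × X × B × Y × Z => a.1,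
    comp_update fun a : W × Wh × X × B × Y × Z => a.2.1,
    comp_update fun a : W × Wh × X × B × Y × Z => a.2.2.1,
    comp_update fun a : W × Wh × X × B × Y × Z => a.2.2.2.1,
    comp_update fun a : W × Wh × X × B × Y × Z => a.2.2.2.2.1,
    comp_update fun a : W × Wh × X × B × Y × Z => a.2.2.2.2.2, Function.update_self]
  rw [C.enc_causal k _ _ _ _ _ _ (Function.update (fun i => (ω i).2.2.2.1) k b)
      (fun i => (ω i).2.2.2.1) (fun _ _ => rfl) (fun _ _ => rfl) (fun _ _ => rfl)
      (fun i hi => Function.update_of_ne hi.ne _ _),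
    C.decY_causal k _ _ _ _ _ _ (Function.update (fun i => (ω i).2.2.2.2.1) k y)
      (fun i => (ω i).2.2.2.2.1) (fun _ _ => rfl) (fun _ _ => rfl) (fun _ _ => rfl)
      (fun i hi => Function.update_of_ne hi.ne _ _),
    C.decZ_causal k _ _ _ _ (Function.update (fun i => (ω i).2.2.2.2.2) k z)
      (fun i => (ω i).2.2.2.2.2) (fun _ _ => rfl) (fun _ _ => rfl)
      (fun i hi => Function.update_of_ne hi.ne _ _)]

variable {PW PWh πX}

lemma sum_factor_update (hX : IsDist πX) (k : Fin n) (ω : Fin n → W × Wh × X × B × Y × Z)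
    (φ : W → Wh → ℝ) :
    ∑ a, C.factor PW PWh πX k (Function.update ω k a) * φ a.1 a.2.1 =
      ∑ w, PW w * ∑ wh, PWh wh * φ w wh := by
  simp only [Fintype.sum_prod_type, factor_update, mul_assoc, ← Finset.mul_sum]
  simp only [← Finset.sum_mul, (C.decZ_dist _ _ _ _).2, (C.decY_dist _ _ _ _ _).2,
    (C.enc_dist _ _ _ _ _).2, hX.2, one_mul]

lemma isCausal_factor (hW : IsDist PW) (hWh : IsDist PWh) (hX : IsDist πX) :
    IsCausal (C.factor PW PWh πX) where
  nonneg k ω := mul_nonneg (hW.1 _) <| mul_nonneg (hWh.1 _) <| mul_nonneg (hX.1 _) <|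
    mul_nonneg ((C.enc_dist ..).1 _) <| mul_nonneg ((C.decY_dist ..).1 _) ((C.decZ_dist ..).1 _)
  sum_eq_one k ω := by
    simpa [hW.2, hWh.2] using C.sum_factor_update (PW := PW) (PWh := PWh) hX k ω fun _ _ => 1
  congr k ω ω' h := by
    unfold factor
    rw [h k le_rfl, C.enc_causal k (fun i => (ω i).1) (fun i => (ω' i).1) (fun i => (ω i).2.1)
        (fun i => (ω' i).2.1) (fun i => (ω i).2.2.1) (fun i => (ω' i).2.2.1)
        (fun i => (ω i).2.2.2.1) (fun i => (ω' i).2.2.2.1) (fun i hi => by simp only [h i hi])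
        (fun i hi => by simp only [h i hi]) (fun i hi => by simp only [h i hi])
        (fun i hi => by simp only [h i hi.le]),
      C.decY_causal k (fun i => (ω i).1) (fun i => (ω' i).1) (fun i => (ω i).2.1)
        (fun i => (ω' i).2.1) (fun i => (ω i).2.2.2.1) (fun i => (ω' i).2.2.2.1)
        (fun i => (ω i).2.2.2.2.1) (fun i => (ω' i).2.2.2.2.1) (fun i hi => by simp only [h i hi])
        (fun i hi => by simp only [h i hi]) (fun i hi => by simp only [h i hi])
        (fun i hi => by simp only [h i hi.le]),
      C.decZ_causal k (fun i => (ω i).1) (fun i => (ω' i).1) (fun i => (ω i).2.2.2.1)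
        (fun i => (ω' i).2.2.2.1) (fun i => (ω i).2.2.2.2.2) (fun i => (ω' i).2.2.2.2.2)
        (fun i hi => by simp only [h i hi]) (fun i hi => by simp only [h i hi])
        (fun i hi => by simp only [h i hi.le])]

variable (PW PWh πX) in
/-- The joint law of all the symbols produced by a code. -/
def law (ω : Fin n → W × Wh × X × B × Y × Z) : ℝ := ∏ k, C.factor PW PWh πX k ω

lemma marg_law : marg (fun ω => ((fun i => (ω i).2.2.1), (fun i => (ω i).2.2.2.2.1),
      (fun i => (ω i).2.2.2.2.2))) (C.law PW PWh πX) =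
    fun p : (Fin n → X) × (Fin n → Y) × (Fin n → Z) =>
      (∏ i, πX (p.1 i)) * C.channel PW PWh p.1 p.2.1 p.2.2 := by
  funext ⟨x, y, z⟩
  let e : (Fin n → W × Wh × X × B × Y × Z) ≃
      (Fin n → W) × (Fin n → Wh) × (Fin n → X) × (Fin n → B) × (Fin n → Y) × (Fin n → Z) :=
    { toFun := fun ω => (fun i => (ω i).1, fun i => (ω i).2.1, fun i => (ω i).2.2.1,
        fun i => (ω i).2.2.2.1, fun i => (ω i).2.2.2.2.1, fun i => (ω i).2.2.2.2.2)
      invFun := fun t i => (t.1 i, t.2.1 i, t.2.2.1 i, t.2.2.2.1 i, t.2.2.2.2.1 i, t.2.2.2.2.2 i)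
      left_inv := fun _ => rfl
      right_inv := fun _ => rfl }
  rw [marg, ← e.symm.sum_comp]
  simp only [Fintype.sum_prod_type, e, Equiv.coe_fn_symm_mk, channel, Finset.mul_sum,
    Prod.mk.injEq, law, factor, Finset.prod_mul_distrib]
  refine Finset.sum_congr rfl fun w _ => Finset.sum_congr rfl fun wh _ => ?_
  rw [Finset.sum_comm]
  refine Finset.sum_congr rfl fun b _ => ?_
  simp only [ite_and, Finset.sum_ite_eq', Finset.sum_ite_irrel, Finset.sum_const_zero,
    Finset.mem_univ, if_true]
  ring

section Auxiliary

variable (a₀ : W × Wh × X × B × Y × Z)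

/-- `P_{B|XUÛV}` of the single-letterized code. -/
def kerB (t : X × ((Fin n → W) × (Fin n → B)) × (Fin n → Wh) ×
    (Fin n × (Fin n → X) × (Fin n → Y) × (Fin n → Z))) : B → ℝ :=
  C.enc t.2.2.2.1 t.2.1.1 t.2.2.1 (Function.update t.2.2.2.2.1 t.2.2.2.1 t.1) t.2.1.2

/-- `P_{Y|BUÛV}` of the single-letterized code. -/
def kerY (t : B × ((Fin n → W) × (Fin n → B)) × (Fin n → Wh) ×
    (Fin n × (Fin n → X) × (Fin n → Y) × (Fin n → Z))) : Y → ℝ :=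
  C.decY t.2.2.2.1 t.2.1.1 t.2.2.1 (Function.update t.2.1.2 t.2.2.2.1 t.1) t.2.2.2.2.2.1

/-- `P_{Z|BUV}` of the single-letterized code. -/
def kerZ (t : B × ((Fin n → W) × (Fin n → B)) ×
    (Fin n × (Fin n → X) × (Fin n → Y) × (Fin n → Z))) : Z → ℝ :=
  C.decZ t.2.2.1 t.2.1.1 (Function.update t.2.1.2 t.2.2.1 t.1) t.2.2.2.2.2

lemma factor_eq_ker (k : Fin n) (ω : Fin n → W × Wh × X × B × Y × Z) :
    C.factor PW PWh πX k ω = PW (ω k).1 * (PWh (ω k).2.1 * (πX (ω k).2.2.1 *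
      (C.kerB ((ω k).2.2.1, auxU a₀ k ω, auxUh a₀ k ω, (k, auxV a₀ k ω)) (ω k).2.2.2.1 *
      (C.kerY ((ω k).2.2.2.1, auxU a₀ k ω, auxUh a₀ k ω, (k, auxV a₀ k ω)) (ω k).2.2.2.2.1 *
      C.kerZ ((ω k).2.2.2.1, auxU a₀ k ω, (k, auxV a₀ k ω)) (ω k).2.2.2.2.2)))) := by
  have lt {α : Type} (d : α) (f : Fin n → α) (i : Fin n) (hi : i < k) :
      f i = truncate d k f i := by
    simp [truncate, hi]
  have le {α : Type} (d : α) (f : Fin n → α) (i : Fin n) (hi : i ≤ k) :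
      f i = truncate d (k + 1) f i := by
    simp [truncate, Nat.lt_succ_of_le (Fin.le_def.mp hi)]
  have upd {α : Type} (d : α) (f : Fin n → α) (i : Fin n) (hi : i ≤ k) :
      f i = Function.update (truncate d k f) k (f k) i := by
    rcases hi.eq_or_lt with rfl | h
    · simp
    · rw [Function.update_of_ne h.ne, ← lt d f i h]
  unfold factor
  congr 4
  · exact congrFun (C.enc_causal k _ _ _ _ _ _ _ _ (le _ _) (le _ _) (upd _ _) (lt _ _)) _
  congr 1
  · exact congrFun (C.decY_causal k _ _ _ _ _ _ _ _ (le _ _) (le _ _) (upd _ _) (lt _ _)) _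
  · exact congrFun (C.decZ_causal k _ _ _ _ _ _ (le _ _) (upd _ _) (lt _ _)) _

lemma marg_step (hW : IsDist PW) (hWh : IsDist PWh) (hX : IsDist πX) (k : Fin n)
    (x : X) (u : (Fin n → W) × (Fin n → B)) (uh : Fin n → Wh)
    (v : (Fin n → X) × (Fin n → Y) × (Fin n → Z)) (b : B) (y : Y) (z : Z) :
    marg (fun ω => ((auxU a₀ k ω, auxUh a₀ k ω, auxV a₀ k ω),
        (ω k).2.2.1, (ω k).2.2.2.1, (ω k).2.2.2.2.1, (ω k).2.2.2.2.2))
      (C.law PW PWh πX) ((u, uh, v), x, b, y, z) =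
    πX x * marg (fun ω => (auxU a₀ k ω, auxUh a₀ k ω, auxV a₀ k ω)) (C.law PW PWh πX) (u, uh, v) *
      C.kerB (x, u, uh, (k, v)) b * C.kerY (b, u, uh, (k, v)) y * C.kerZ (b, u, (k, v)) z := by
  have hK := C.isCausal_factor hW hWh hX
  let I (ω : Fin n → W × Wh × X × B × Y × Z) : ℝ :=
    if (auxU a₀ k ω, auxUh a₀ k ω, auxV a₀ k ω) = (u, uh, v) then 1 else 0
  let E (a : W × Wh × X × B × Y × Z) : ℝ :=
    if (a.2.2.1, a.2.2.2.1, a.2.2.2.2.1, a.2.2.2.2.2) = (x, b, y, z) then 1 else 0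
  have hI (ω ω' : Fin n → W × Wh × X × B × Y × Z) (h : ∀ i < k, ω i = ω' i)
      (h₁ : (ω k).1 = (ω' k).1) (h₂ : (ω k).2.1 = (ω' k).2.1) : I ω = I ω' := by
    simp only [I, auxU_congr a₀ h h₁, auxUh_congr a₀ h h₂, auxV_congr a₀ h]
  have hl : marg (fun ω => ((auxU a₀ k ω, auxUh a₀ k ω, auxV a₀ k ω),
        (ω k).2.2.1, (ω k).2.2.2.1, (ω k).2.2.2.2.1, (ω k).2.2.2.2.2))
      (C.law PW PWh πX) ((u, uh, v), x, b, y, z) =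
      ∑ ω, (∏ i, C.factor PW PWh πX i ω) * (I ω * E (ω k)) := by
    refine Finset.sum_congr rfl fun ω _ => ?_
    simp only [Prod.mk.injEq, I, E, law, ← ite_and, mul_ite, mul_one, mul_zero]
    exact if_congr and_comm rfl rfl
  have hr : marg (fun ω => (auxU a₀ k ω, auxUh a₀ k ω, auxV a₀ k ω)) (C.law PW PWh πX) (u, uh, v) =
      ∑ ω, (∏ i, C.factor PW PWh πX i ω) * I ω :=
    Finset.sum_congr rfl fun ω _ => by simp [I, law]
  rw [hl, hr, hK.sum_resample a₀ k _ fun ω ω' h => by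
      rw [hI ω ω' (fun i hi => h i hi.le) (by rw [h k le_rfl]) (by rw [h k le_rfl]), h k le_rfl],
    hK.sum_resample a₀ k I fun ω ω' h =>
      hI ω ω' (fun i hi => h i hi.le) (by rw [h k le_rfl]) (by rw [h k le_rfl]),
    Finset.mul_sum, Finset.sum_mul, Finset.sum_mul, Finset.sum_mul]
  refine Finset.sum_congr rfl fun ω _ => ?_
  let J (w : W) (wh : Wh) : ℝ := I (Function.update ω k (w, wh, a₀.2.2))
  have hJ (a : W × Wh × X × B × Y × Z) : I (Function.update ω k a) = J a.1 a.2.1 :=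
    hI _ _ (fun i hi => by simp [hi.ne]) (by simp) (by simp)
  have hE : ∑ a : W × Wh × X × B × Y × Z, PW a.1 * (PWh a.2.1 * (J a.1 a.2.1 * E a)) =
      ∑ w, PW w * ∑ wh, PWh wh * J w wh := by
    simp only [Fintype.sum_prod_type, ← Finset.mul_sum, E, Prod.mk.injEq, ite_and,
      Finset.sum_ite_irrel, Finset.sum_const_zero, Finset.sum_ite_eq', Finset.mem_univ, if_true,
      mul_one]
  have hterm (a : W × Wh × X × B × Y × Z) :
      C.factor PW PWh πX k (Function.update ω k a) * (J a.1 a.2.1 * E a) =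
        πX x * C.kerB (x, u, uh, (k, v)) b * C.kerY (b, u, uh, (k, v)) y *
          C.kerZ (b, u, (k, v)) z * (PW a.1 * (PWh a.2.1 * (J a.1 a.2.1 * E a))) := by
    rw [← hJ]
    by_cases h₁ : (a.2.2.1, a.2.2.2.1, a.2.2.2.2.1, a.2.2.2.2.2) = (x, b, y, z)
    · by_cases h₂ : (auxU a₀ k (Function.update ω k a), auxUh a₀ k (Function.update ω k a),
          auxV a₀ k (Function.update ω k a)) = (u, uh, v)
      · rw [C.factor_eq_ker a₀]
        simp only [Prod.mk.injEq] at h₁ h₂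
        simp only [Function.update_self, h₁, h₂]
        ring
      · simp only [I, if_neg h₂, zero_mul, mul_zero]
    · simp only [E, if_neg h₁, mul_zero]
  simp only [hJ, Function.update_self, hterm, ← Finset.mul_sum, hE, C.sum_factor_update hX]
  ring

lemma marg_timeShare_law (hW : IsDist PW) (hWh : IsDist PWh) (hX : IsDist πX) :
    marg (fun q : Fin n × (Fin n → W × Wh × X × B × Y × Z) => ((q.2 q.1).2.2.1, auxU a₀ q.1 q.2,
        auxUh a₀ q.1 q.2, (q.1, auxV a₀ q.1 q.2), (q.2 q.1).2.2.2.1, (q.2 q.1).2.2.2.2.1,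
        (q.2 q.1).2.2.2.2.2)) (timeShare n (C.law PW PWh πX)) =
      bJoint πX (marg (fun q => (auxU a₀ q.1 q.2, auxUh a₀ q.1 q.2, (q.1, auxV a₀ q.1 q.2)))
        (timeShare n (C.law PW PWh πX))) C.kerB C.kerY C.kerZ := by
  funext ⟨x, u, uh, ⟨k, v⟩, b, y, z⟩
  have hl := marg_timeShare n (C.law PW PWh πX) (fun k ω => ((auxU a₀ k ω, auxUh a₀ k ω,
    auxV a₀ k ω), (ω k).2.2.1, (ω k).2.2.2.1, (ω k).2.2.2.2.1, (ω k).2.2.2.2.2)) k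
    ((u, uh, v), x, b, y, z)
  have hr := marg_timeShare n (C.law PW PWh πX)
    (fun k ω => (auxU a₀ k ω, auxUh a₀ k ω, auxV a₀ k ω)) k (u, uh, v)
  rw [C.marg_step a₀ hW hWh hX] at hl
  have hP : marg (fun q : Fin n × (Fin n → W × Wh × X × B × Y × Z) => (auxU a₀ q.1 q.2,
      auxUh a₀ q.1 q.2, (q.1, auxV a₀ q.1 q.2))) (timeShare n (C.law PW PWh πX))
      (u, uh, (k, v)) = _ :=
    (marg_apply_congr_iff _ fun q => by simp only [Prod.mk.injEq]; tauto).trans hr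
  refine ((marg_apply_congr_iff _ fun q => ?_).trans hl).trans ?_
  · simp only [Prod.mk.injEq]
    tauto
  · simp only [bJoint, hP]
    ring

lemma isKernel_kerB : IsKernel C.kerB := fun _ => C.enc_dist ..

lemma isKernel_kerY : IsKernel C.kerY := fun _ => C.decY_dist ..

lemma isKernel_kerZ : IsKernel C.kerZ := fun _ => C.decZ_dist ..

lemma isDist_law (a₀ : W × Wh × X × B × Y × Z) (hW : IsDist PW) (hWh : IsDist PWh) (hX : IsDist πX) :
    IsDist (C.law PW PWh πX) :=
  (C.isCausal_factor hW hWh hX).isDist a₀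

lemma ent_auxU (hW : IsDist PW) (hWh : IsDist PWh) (hX : IsDist πX) (k : Fin n) :
    ent (marg (fun ω => (auxU a₀ k ω, auxV a₀ k ω)) (C.law PW PWh πX)) =
      ent PW + ent (marg (pastU a₀ k) (C.law PW PWh πX)) := by
  rw [← ent_prod hW (isDist_marg _ (C.isDist_law a₀ hW hWh hX))]
  refine Eq.trans (ent_marg_congr _ fun ω ω' => ?_) (congrArg ent
    ((C.isCausal_factor hW hWh hX).marg_prod a₀ k Prod.fst PW (fun ω w => ?_) (pastU a₀ k)
      fun ω ω' => pastU_congr a₀))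
  · simp only [auxU, pastU, Prod.mk.injEq, truncate_succ_eq_iff]
    tauto
  · simpa [hWh.2] using
      C.sum_factor_update (PW := PW) (PWh := PWh) hX k ω fun w' _ => if w' = w then 1 else 0

lemma ent_auxU_auxUh (hW : IsDist PW) (hWh : IsDist PWh) (hX : IsDist πX) (k : Fin n) :
    ent (marg (fun ω => ((auxU a₀ k ω, auxUh a₀ k ω), auxV a₀ k ω)) (C.law PW PWh πX)) =
      ent PW + ent PWh + ent (marg (pastUUh a₀ k) (C.law PW PWh πX)) := by
  have hWWh : IsDist fun r : W × Wh => PW r.1 * PWh r.2 :=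
    ⟨fun r => mul_nonneg (hW.1 _) (hWh.1 _), by
      simp [Fintype.sum_prod_type, ← Finset.mul_sum, hW.2, hWh.2]⟩
  rw [← ent_prod hW hWh, ← ent_prod hWWh (isDist_marg _ (C.isDist_law a₀ hW hWh hX))]
  refine Eq.trans (ent_marg_congr _ fun ω ω' => ?_) (congrArg ent
    ((C.isCausal_factor hW hWh hX).marg_prod a₀ k (fun a => (a.1, a.2.1))
      (fun r => PW r.1 * PWh r.2) (fun ω r => ?_)
      (pastUUh a₀ k) fun ω ω' => pastUUh_congr a₀))
  · simp only [auxU, auxUh, pastUUh, pastU, Prod.mk.injEq, truncate_succ_eq_iff]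
    tauto
  · simpa [ite_and, Prod.ext_iff] using C.sum_factor_update (PW := PW) (PWh := PWh) hX k ω
      fun w wh => if (w, wh) = r then 1 else 0

/-- Single-letterization: the normalized divergence of a code is at least the lower bound. -/
lemma sInf_bDeltaSet_le (hn : n ≠ 0) (hW : IsDist PW) (hWh : IsDist PWh) {π : X × Y × Z → ℝ}
    (hπ : IsDist π) (a₀ : W × Wh × X × B × Y × Z) :
    sInf (bDeltaSet X Y Z B π (ent PW) (ent PWh) false) ≤
      KL (fun p : (Fin n → X) × (Fin n → Y) × (Fin n → Z) =>
          (∏ i, marg (fun q : X × Y × Z => q.1) π (p.1 i)) * C.channel PW PWh p.1 p.2.1 p.2.2)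
        (fun p => ∏ i, π (p.1 i, p.2.1 i, p.2.2 i)) / n := by
  have hX : IsDist (marg (fun q : X × Y × Z => q.1) π) := isDist_marg _ hπ
  set πX := marg (fun q : X × Y × Z => q.1) π
  have hL := C.isDist_law a₀ hW hWh hX
  have hL' := isDist_timeShare hn hL
  rw [← C.marg_law]
  set p := C.law PW PWh πX
  have hpast0 : ent (marg (pastU a₀ 0) p) = 0 := ent_marg_of_const hL fun ω ω' => by
    simp [pastU, auxV, truncate_eq_iff]
  have hpast0' : ent (marg (pastUUh a₀ 0) p) = 0 := ent_marg_of_const hL fun ω ω' => by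
    simp [pastUUh, pastU, auxV, truncate_eq_iff]
  have hV0 : ent (marg (auxV a₀ 0) p) = 0 := ent_marg_of_const hL fun ω ω' => by
    simp [auxV, truncate_eq_iff]
  have hVn : ent (marg (auxV a₀ n) p) ≤ ent (marg (pastU a₀ n) p) :=
    ent_marg_mono hL.1 fun ω ω' h => by
      simp only [pastU, Prod.mk.injEq] at h
      exact h.2.2
  have hVn' : ent (marg (auxV a₀ n) p) ≤ ent (marg (pastUUh a₀ n) p) :=
    hVn.trans <| ent_marg_mono hL.1 fun ω ω' h => by
      simp only [pastUUh, Prod.mk.injEq] at h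
      exact h.2
  have entV : ent (marg (fun q : Fin n × (Fin n → W × Wh × X × B × Y × Z) => (q.1, auxV a₀ q.1 q.2))
      (timeShare n p)) = _ := ent_timeShare hn hL fun k ω => auxV a₀ k ω
  have entVsucc := ent_timeShare hn hL fun k ω => auxV a₀ (k + 1) ω
  have hsucc : ent (marg (fun q : Fin n × (Fin n → W × Wh × X × B × Y × Z) =>
      ((q.2 q.1).2.2.1, (q.2 q.1).2.2.2.2.1, (q.2 q.1).2.2.2.2.2, (q.1, auxV a₀ q.1 q.2)))
      (timeShare n p)) = _ := (ent_marg_congr _ fun q q' => by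
    obtain ⟨k, ω⟩ := q
    obtain ⟨k', ω'⟩ := q'
    simp only [Prod.mk.injEq]
    constructor
    · rintro ⟨h₁, h₂, h₃, rfl, h₄⟩
      simp only [auxV, Prod.mk.injEq, truncate_succ_eq_iff] at h₄ ⊢
      tauto
    · rintro ⟨rfl, h⟩
      simp only [auxV, Prod.mk.injEq, truncate_succ_eq_iff] at h ⊢
      tauto).trans entVsucc
  have hmem := KL_mem_bDeltaSet (π := π) (hW := ent PW) (hWh := ent PWh) hL'
    (fun q => (q.2 q.1).2.2.1) (fun q => auxU a₀ q.1 q.2)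
    (fun q => auxUh a₀ q.1 q.2) (fun q => (q.1, auxV a₀ q.1 q.2)) (fun q => (q.2 q.1).2.2.2.1)
    (fun q => (q.2 q.1).2.2.2.2.1) (fun q => (q.2 q.1).2.2.2.2.2) C.isKernel_kerB C.isKernel_kerY
    C.isKernel_kerZ (C.marg_timeShare_law a₀ hW hWh hX) ?_ ?_
  · refine (sInf_le hmem).trans ?_
    by_cases hac : ∀ t : (Fin n → X) × (Fin n → Y) × (Fin n → Z),
        ∏ i, π (t.1 i, t.2.1 i, t.2.2 i) = 0 → marg (fun ω => ((fun i => (ω i).2.2.1),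
          (fun i => (ω i).2.2.2.2.1), (fun i => (ω i).2.2.2.2.2))) p t = 0
    swap
    · rw [KL.eq_1 (marg _ p), if_neg hac, ENNReal.top_div_of_ne_top (ENNReal.natCast_ne_top n)]
      exact le_top
    have hpos (ω : Fin n → W × Wh × X × B × Y × Z) (hω : p ω ≠ 0) (k : Fin n) :
        π ((ω k).2.2.1, (ω k).2.2.2.2.1, (ω k).2.2.2.2.2) ≠ 0 := fun h =>
      (marg_pos _ hL.1 hω).ne' (hac _ (Finset.prod_eq_zero (Finset.mem_univ k) h))
    have hn' : (0 : ℝ) < n := by exact_mod_cast hn.bot_lt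
    have hV (q : Fin n × (Fin n → W × Wh × X × B × Y × Z)) (hq : timeShare n p q ≠ 0) :=
      (marg_pos (fun q => (q.1, auxV a₀ q.1 q.2)) hL'.1 hq).ne'
    have hπq (q : Fin n × (Fin n → W × Wh × X × B × Y × Z)) (hq : timeShare n p q ≠ 0) :=
      hpos q.2 (fun h => hq (by simp [timeShare, h])) q.1
    rw [KL_marg _ hL'.1, KL_marg _ hL.1 hac, ← ENNReal.ofReal_natCast n,
      ← ENNReal.ofReal_div_of_pos hn']
    swap
    · intro r hr
      refine Finset.sum_eq_zero fun q _ => ?_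
      split_ifs with h
      · subst h
        by_contra hq
        exact (mul_ne_zero (hV q hq) (hπq q hq)) hr
      · rfl
    refine ENNReal.ofReal_le_ofReal (le_of_eq ?_)
    have e₁ : ent (marg (fun q : Fin n × (Fin n → W × Wh × X × B × Y × Z) => ((q.2 q.1).2.2.1,
        (q.1, auxV a₀ q.1 q.2), (q.2 q.1).2.2.2.2.1, (q.2 q.1).2.2.2.2.2)) (timeShare n p)) = _ :=
      (ent_marg_congr _ fun q q' => by simp only [Prod.mk.injEq]; tauto).trans hsucc
    have e₂ : ent (marg (fun ω : Fin n → W × Wh × X × B × Y × Z => ((fun i => (ω i).2.2.1),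
        (fun i => (ω i).2.2.2.2.1), (fun i => (ω i).2.2.2.2.2))) p) = ent (marg (auxV a₀ n) p) :=
      ent_marg_congr _ fun ω ω' => by
        simp only [auxV, Prod.mk.injEq, truncate_eq_iff]
        simp [funext_iff]
    have e₃ : ∑ q, timeShare n p q * Real.log (marg (fun q => (q.1, auxV a₀ q.1 q.2))
        (timeShare n p) (q.1, auxV a₀ q.1 q.2) *
          π ((q.2 q.1).2.2.1, (q.2 q.1).2.2.2.2.1, (q.2 q.1).2.2.2.2.2)) =
        -ent (marg (fun q => (q.1, auxV a₀ q.1 q.2)) (timeShare n p)) + (∑ k, ∑ ω, p ω *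
          Real.log (π ((ω k).2.2.1, (ω k).2.2.2.2.1, (ω k).2.2.2.2.2))) / n := by
      rw [ent_marg, neg_neg, ← sum_timeShare_mul n p fun q =>
        Real.log (π ((q.2 q.1).2.2.1, (q.2 q.1).2.2.2.2.1, (q.2 q.1).2.2.2.2.2)),
        ← Finset.sum_add_distrib]
      refine Finset.sum_congr rfl fun q _ => ?_
      by_cases hq : timeShare n p q = 0
      · simp [hq]
      · rw [Real.log_mul (hV q hq) (hπq q hq), mul_add]
    have e₄ : ∑ ω, p ω * Real.log (∏ k, π ((ω k).2.2.1, (ω k).2.2.2.2.1, (ω k).2.2.2.2.2)) =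
        ∑ k, ∑ ω, p ω * Real.log (π ((ω k).2.2.1, (ω k).2.2.2.2.1, (ω k).2.2.2.2.2)) := by
      rw [Finset.sum_comm]
      refine Finset.sum_congr rfl fun ω _ => ?_
      rw [← Finset.mul_sum]
      by_cases hω : p ω = 0
      · simp [hω]
      · rw [Real.log_prod fun k _ => hpos ω hω k]
    rw [e₁, e₂, e₃, e₄, entV,
      sum_fin_succ_eq fun k => ent (marg (fun ω => auxV a₀ k ω) p), hV0]
    ring
  · rw [entV, hsucc]
    have e₁ : ent (marg (fun q : Fin n × (Fin n → W × Wh × X × B × Y × Z) =>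
        (auxU a₀ q.1 q.2, (q.1, auxV a₀ q.1 q.2))) (timeShare n p)) = _ :=
      (ent_marg_congr _ fun q q' => by simp only [Prod.mk.injEq]; tauto).trans
        (ent_timeShare hn hL fun k ω => (auxU a₀ k ω, auxV a₀ k ω))
    have e₂ : ent (marg (fun q : Fin n × (Fin n → W × Wh × X × B × Y × Z) =>
        (((q.2 q.1).2.2.2.1, auxU a₀ q.1 q.2), (q.2 q.1).2.2.1, (q.2 q.1).2.2.2.2.1,
          (q.2 q.1).2.2.2.2.2, (q.1, auxV a₀ q.1 q.2))) (timeShare n p)) = _ :=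
      (ent_marg_congr _ fun q q' => by
        obtain ⟨k, ω⟩ := q
        obtain ⟨k', ω'⟩ := q'
        simp only [Prod.mk.injEq]
        constructor
        · rintro ⟨⟨h₁, h₂⟩, h₃, h₄, h₅, rfl, h₆⟩
          simp only [pastU, auxU, auxV, Prod.mk.injEq, truncate_succ_eq_iff] at h₂ h₆ ⊢
          tauto
        · rintro ⟨rfl, h⟩
          simp only [pastU, auxU, auxV, Prod.mk.injEq, truncate_succ_eq_iff] at h ⊢
          tauto).trans (ent_timeShare hn hL fun k ω => pastU a₀ (k + 1) ω)
    rw [e₁, e₂]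
    have := sum_sub_le_of_telescoping hn (s := fun k => ent (marg (pastU a₀ k) p))
      (v := fun k => ent (marg (auxV a₀ k) p)) (C.ent_auxU a₀ hW hWh hX) hpast0 hV0 hVn
    linarith
  · rw [entV, hsucc]
    have e₁ : ent (marg (fun q : Fin n × (Fin n → W × Wh × X × B × Y × Z) =>
        ((auxU a₀ q.1 q.2, auxUh a₀ q.1 q.2), (q.1, auxV a₀ q.1 q.2))) (timeShare n p)) = _ :=
      (ent_marg_congr _ fun q q' => by simp only [Prod.mk.injEq]; tauto).trans
        (ent_timeShare hn hL fun k ω => ((auxU a₀ k ω, auxUh a₀ k ω), auxV a₀ k ω))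
    have e₂ : ent (marg (fun q : Fin n × (Fin n → W × Wh × X × B × Y × Z) =>
        (((q.2 q.1).2.2.2.1, auxU a₀ q.1 q.2, auxUh a₀ q.1 q.2), (q.2 q.1).2.2.1,
          (q.2 q.1).2.2.2.2.1, (q.2 q.1).2.2.2.2.2, (q.1, auxV a₀ q.1 q.2))) (timeShare n p)) = _ :=
      (ent_marg_congr _ fun q q' => by
        obtain ⟨k, ω⟩ := q
        obtain ⟨k', ω'⟩ := q'
        simp only [Prod.mk.injEq]
        constructor
        · rintro ⟨⟨h₁, h₂, h₇⟩, h₃, h₄, h₅, rfl, h₆⟩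
          simp only [pastUUh, pastU, auxU, auxUh, auxV, Prod.mk.injEq, truncate_succ_eq_iff]
            at h₂ h₆ h₇ ⊢
          tauto
        · rintro ⟨rfl, h⟩
          simp only [pastUUh, pastU, auxU, auxUh, auxV, Prod.mk.injEq, truncate_succ_eq_iff] at h ⊢
          tauto).trans (ent_timeShare hn hL fun k ω => pastUUh a₀ (k + 1) ω)
    rw [e₁, e₂]
    have := sum_sub_le_of_telescoping hn (s := fun k => ent (marg (pastUUh a₀ k) p))
      (v := fun k => ent (marg (auxV a₀ k) p)) (C.ent_auxU_auxUh a₀ hW hWh hX) hpast0' hV0 hVn'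
    linarith

end Auxiliary

end BCode

end CodeLaw

/-- broadcast lower bound: if `Γ(π_{XYZ}, P_W P_Ŵ)` is the limit of
the normalized least divergences, then `Γ ≥ Δ(π_{XYZ}, P_W P_Ŵ)`. -/
theorem broadcast_sequential_synthesis_lower_bound
    (W Wh X Y Z B : Type) [Fintype W] [Fintype Wh] [Fintype X]
    [Fintype Y] [Fintype Z] [Fintype B]
    (PW : W → ℝ) (hPW : IsDist PW) (PWh : Wh → ℝ) (hPWh : IsDist PWh)
    (π : X × Y × Z → ℝ) (hπ : IsDist π)
    (hB : 2 ≤ Fintype.card B)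
    (hyz : ∃ y : Y, ∃ z : Z, ∀ x : X,
      0 < marg (fun q : X × Y × Z => q.1) π x → 0 < π (x, y, z))
    (G : ℝ≥0∞)
    (hG : Filter.Tendsto (fun n : ℕ => BGammaN W Wh X Y Z B PW PWh π n / (n : ℝ≥0∞))
      Filter.atTop (nhds G)) :
    sInf (bDeltaSet X Y Z B π (ent PW) (ent PWh) false) ≤ G := by
  have hne {α : Type} [Fintype α] {p : α → ℝ} (hp : IsDist p) : Nonempty α := by
    by_contra h
    rw [not_nonempty_iff] at h
    simpa using hp.2
  obtain ⟨w⟩ := hne hPW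
  obtain ⟨wh⟩ := hne hPWh
  obtain ⟨x, y, z⟩ := hne hπ
  obtain ⟨b⟩ : Nonempty B := Fintype.card_pos_iff.mp (by omega)
  refine ge_of_tendsto hG ((Filter.eventually_ne_atTop 0).mono fun n hn => ?_)
  have hn' : (n : ℝ≥0∞) ≠ 0 := by exact_mod_cast hn
  rw [ENNReal.le_div_iff_mul_le (Or.inl hn') (Or.inl (ENNReal.natCast_ne_top n))]
  refine le_sInf ?_
  rintro _ ⟨C, rfl⟩
  rw [← ENNReal.le_div_iff_mul_le (Or.inl hn') (Or.inl (ENNReal.natCast_ne_top n))]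
  exact C.sInf_bDeltaSet_le hn hPW hPWh hπ (w, wh, x, b, y, z)

end
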